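/- Let E be a real Hilbert space and let f : E → ℝ be differentiable everywhere with L-Lipschitz gradient, L ≥ 0. Fix x, x̂, G ∈ E, γ ≥ 0, λ ≥ 0, and suppose ⟨x̂ − x, G⟩ ≤ −λ‖x̂ − x‖². Let W > 0 and λ̃ > 0 be constants such that ‖x̂ − x‖ ≥ W and λ − (L/2)γ − ‖∇f(x) − G‖ / W ≥ λ̃. Then the updated point x⁺ = x + γ(x̂ − x) satisfies f(x⁺) ≤ f(x) − λ̃ W² γ; that is, the objective strictly decreases by at least λ̃ W² γ in this iteration. -/

import Mathlib

open RealInnerProductSpace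

/-- The descent lemma for a function with Lipschitz gradient. -/
theorem le_add_inner_add_of_lipschitz_gradient {E : Type*} [NormedAddCommGroup E]
    [InnerProductSpace ℝ E] [CompleteSpace E] {f : E → ℝ} {f' : E → E} {L : ℝ}
    (hgrad : ∀ x, HasGradientAt f (f' x) x)
    (hlip : ∀ x y, ‖f' x - f' y‖ ≤ L * ‖x - y‖) (x d : E) :
    f (x + d) ≤ f x + ⟪f' x, d⟫ + L / 2 * ‖d‖ ^ 2 := by
  have hφ (t : ℝ) : HasDerivAt (fun s : ℝ => f (x + s • d)) ⟪f' (x + t • d), d⟫ t := by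
    have hline : HasDerivAt (fun s : ℝ => x + s • d) d t := by
      simpa using ((hasDerivAt_id t).smul_const d).const_add x
    exact ((hgrad (x + t • d)).hasFDerivAt.comp_hasDerivAt t hline).congr_deriv (by simp)
  have hB (t : ℝ) : HasDerivAt
      (fun s : ℝ => f x + s * ⟪f' x, d⟫ + L / 2 * ‖d‖ ^ 2 * s ^ 2)
      (⟪f' x, d⟫ + L * ‖d‖ ^ 2 * t) t := by
    refine ((((hasDerivAt_id t).mul_const ⟪f' x, d⟫).const_add (f x)).add
      ((hasDerivAt_pow 2 t).const_mul (L / 2 * ‖d‖ ^ 2))).congr_deriv ?_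
    push_cast
    ring
  have hle := image_le_of_deriv_right_le_deriv_boundary (a := 0) (b := 1)
    (fun t _ => (hφ t).continuousAt.continuousWithinAt)
    (fun t _ => (hφ t).hasDerivWithinAt) (by simp)
    (fun t _ => (hB t).continuousAt.continuousWithinAt)
    (fun t _ => (hB t).hasDerivWithinAt)
    (fun t ht => by
      have h1 : ‖f' (x + t • d) - f' x‖ ≤ L * (t * ‖d‖) := by
        simpa [norm_smul, abs_of_nonneg ht.1] using hlip (x + t • d) x
      have h2 := real_inner_le_norm (f' (x + t • d) - f' x) d
      rw [inner_sub_left] at h2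
      nlinarith [mul_le_mul_of_nonneg_right h1 (norm_nonneg d)])
    (Set.right_mem_Icc.2 zero_le_one)
  simpa using hle

/-- Sufficient-decrease step in the proof of Proposition 4. -/
theorem stmt_9 {E : Type*} [NormedAddCommGroup E] [InnerProductSpace ℝ E] [CompleteSpace E]
    (f : E → ℝ) (f' : E → E) (L : ℝ) (hL : 0 ≤ L)
    (hgrad : ∀ x, HasGradientAt f (f' x) x)
    (hlip : ∀ x y, ‖f' x - f' y‖ ≤ L * ‖x - y‖)
    (x xhat G : E) (γ lam : ℝ) (hγ : 0 ≤ γ) (hlam : 0 ≤ lam)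
    (hdesc : ⟪xhat - x, G⟫ ≤ -lam * ‖xhat - x‖ ^ 2)
    (W lamt : ℝ) (hW : 0 < W) (hlamt : 0 < lamt)
    (hWle : W ≤ ‖xhat - x‖)
    (hacc : lamt ≤ lam - (L / 2) * γ - ‖f' x - G‖ / W)
    (xplus : E) (hx : xplus = x + γ • (xhat - x)) :
    f xplus ≤ f x - lamt * W ^ 2 * γ := by
  subst hx
  set v := xhat - x
  have hdescent := le_add_inner_add_of_lipschitz_gradient hgrad hlip x (γ • v)
  rw [real_inner_smul_right, norm_smul, Real.norm_of_nonneg hγ] at hdescent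
  have hinner : ⟪f' x, v⟫ ≤ ‖f' x - G‖ * ‖v‖ - lam * ‖v‖ ^ 2 := by
    have h := real_inner_le_norm (f' x - G) v
    rw [inner_sub_left, real_inner_comm v G] at h
    linarith
  have herr : ‖f' x - G‖ * ‖v‖ ≤ ‖f' x - G‖ / W * ‖v‖ ^ 2 := by
    calc ‖f' x - G‖ * ‖v‖ = ‖f' x - G‖ / W * (W * ‖v‖) := by field_simp
      _ ≤ ‖f' x - G‖ / W * (‖v‖ * ‖v‖) := by gcongr
      _ = ‖f' x - G‖ / W * ‖v‖ ^ 2 := by ring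
  have hacc' := mul_le_mul_of_nonneg_right hacc (sq_nonneg ‖v‖)
  have hsq : lamt * W ^ 2 ≤ lamt * ‖v‖ ^ 2 := by gcongr
  have hrate : ⟪f' x, v⟫ + L / 2 * γ * ‖v‖ ^ 2 ≤ -(lamt * W ^ 2) := by linarith
  linarith [mul_le_mul_of_nonneg_left hrate hγ]
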